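/- Let λ > 0 and let (C_i) be a sequence of bounded open convex subsets of ℝⁿ with λ₁(C_i) ≥ λ for every i. If the closures of the C_i converge in Hausdorff distance to the closure of a bounded open convex set C ⊂ ℝⁿ, then λ₁(C) ≥ λ. -/

import Mathlib

open MeasureTheory Set Filter
open scoped ENNReal NNReal

noncomputable section

/-- Euclidean `n`-space. -/
abbrev Euc (n : ℕ) : Type := EuclideanSpace ℝ (Fin n)

/-- The set of parameters `t` such that `p + t • v` lies in `C`. For `C` open bounded
convex, `p ∈ C` and `v ≠ 0` this is an open interval `(t⁻, t⁺)` with `t⁻ < 0 < t⁺`;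
the points `p + t⁻ • v` and `p + t⁺ • v` are the two intersections of the boundary `∂C`
with the line through `p` directed by `v`. -/
def lineParams {n : ℕ} (C : Set (Euc n)) (p v : Euc n) : Set ℝ := {t : ℝ | p + t • v ∈ C}

open Classical in
/-- The Hilbert distance of the convex set `C`: with `a = p + t⁻ • (q - p)` and
`b = p + t⁺ • (q - p)` the two boundary points (so that `a, p, q, b` are in this order),
the cross-ratio `(‖q-a‖ ‖p-b‖)/(‖p-a‖ ‖q-b‖)` equals `((1 - t⁻) t⁺)/((-t⁻)(t⁺ - 1))`. -/
def hDist {n : ℕ} (C : Set (Euc n)) (p q : Euc n) : ℝ :=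
  if p = q then 0
  else
    (1 / 2) * Real.log
      (((1 - sInf (lineParams C p (q - p))) * sSup (lineParams C p (q - p))) /
        ((-sInf (lineParams C p (q - p))) * (sSup (lineParams C p (q - p)) - 1)))

open Classical in
/-- The Hilbert Finsler norm of `u` at `p`: with `p⁺ = p + t⁺ • u`, `p⁻ = p + t⁻ • u`
the two boundary points on the line through `p` directed by `u`, one has
`(1/2)‖u‖(1/‖p-p⁺‖ + 1/‖p-p⁻‖) = (1/2)(1/t⁺ - 1/t⁻)`. -/
def fNorm {n : ℕ} (C : Set (Euc n)) (p u : Euc n) : ℝ :=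
  if u = 0 then 0
  else (1 / 2) * (1 / sSup (lineParams C p u) - 1 / sInf (lineParams C p u))

/-- The dual norm of a linear form `l` at `p`: `sup {l u : ‖u‖_{C,p} = 1}`. -/
def dualNorm {n : ℕ} (C : Set (Euc n)) (p : Euc n) (l : Euc n →L[ℝ] ℝ) : ℝ :=
  sSup ((fun u => l u) '' {u : Euc n | fNorm C p u = 1})

/-- The tangent ball `TB_R(p) = {u : ‖u‖_{C,p} < R}`. -/
def tangentBall {n : ℕ} (C : Set (Euc n)) (p : Euc n) (R : ℝ) : Set (Euc n) :=
  {u : Euc n | fNorm C p u < R}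

/-- `ωₙ`, the Lebesgue volume of the Euclidean unit ball of `ℝⁿ`. -/
def omegaVol (n : ℕ) : ℝ := (volume (Metric.ball (0 : Euc n) 1)).toReal

/-- The Hilbert (Busemann) measure of `C`: density `ωₙ / vol_e(TB_C(p))` against
Lebesgue measure, supported on `C`. -/
def hMeasure {n : ℕ} (C : Set (Euc n)) : Measure (Euc n) :=
  (volume.restrict C).withDensity fun p =>
    ENNReal.ofReal (omegaVol n / (volume (tangentBall C p 1)).toReal)

/-- Admissible test functions: nonzero Lipschitz functions with compact support
contained in `Ω`. -/
def testFuns {n : ℕ} (Ω : Set (Euc n)) : Set (Euc n → ℝ) :=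
  {f : Euc n → ℝ |
    (∃ K : ℝ≥0, LipschitzWith K f) ∧ f ≠ 0 ∧ HasCompactSupport f ∧ tsupport f ⊆ Ω}

/-- The Rayleigh quotient of `f` on `Ω`, with respect to the Hilbert geometry of `C`
(`df` is the a.e.-defined differential of the Lipschitz function `f`). -/
def rayleigh {n : ℕ} (C Ω : Set (Euc n)) (f : Euc n → ℝ) : ℝ :=
  (∫ p in Ω, dualNorm C p (fderiv ℝ f p) ^ 2 ∂hMeasure C) /
    ∫ p in Ω, f p ^ 2 ∂hMeasure C

/-- The Dirichlet bottom of the spectrum `λ₁^C(Ω)`. -/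
def lambda1D {n : ℕ} (C Ω : Set (Euc n)) : ℝ := sInf (rayleigh C Ω '' testFuns Ω)

/-- The bottom of the spectrum `λ₁(C)` of the Hilbert geometry of `C`. -/
def lambda1 {n : ℕ} (C : Set (Euc n)) : ℝ := lambda1D C C

/-- The Gromov product `(x|y)_t = (d(x,t) + d(y,t) - d(x,y))/2`. -/
def gromovProd {n : ℕ} (d : Euc n → Euc n → ℝ) (x y t : Euc n) : ℝ :=
  (d x t + d y t - d x y) / 2

/-- `(C, d_C)` is `δ`-hyperbolic: for all `x y z t` in `C`,
`(x|y)_t ≥ min((x|z)_t, (y|z)_t) - δ`. -/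
def IsDeltaHyp {n : ℕ} (C : Set (Euc n)) (δ : ℝ) : Prop :=
  ∀ x ∈ C, ∀ y ∈ C, ∀ z ∈ C, ∀ t ∈ C,
    gromovProd (hDist C) x y t ≥
      min (gromovProd (hDist C) x z t) (gromovProd (hDist C) y z t) - δ

/-- The metric ball `B_R(x)` of the Hilbert metric of `C`. -/
def hBall {n : ℕ} (C : Set (Euc n)) (x : Euc n) (R : ℝ) : Set (Euc n) :=
  {y ∈ C | hDist C x y < R}

/-- The image of `C` under the homothety of center `P₀` and ratio `r`. -/
def homoth {n : ℕ} (P₀ : Euc n) (r : ℝ) (C : Set (Euc n)) : Set (Euc n) :=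
  (fun x => P₀ + r • (x - P₀)) '' C

/-- Diameter of a set with respect to a distance function `d`. -/
def ediamD {α : Type*} (d : α → α → ℝ) (S : Set α) : ℝ≥0∞ :=
  ⨆ x ∈ S, ⨆ y ∈ S, ENNReal.ofReal (d x y)

/-- The `k`-dimensional Hausdorff measure of `S` with respect to the distance
function `d`. -/
def hausD {α : Type*} (k : ℝ) (d : α → α → ℝ) (S : Set α) : ℝ≥0∞ :=
  ⨆ (ε : ℝ≥0∞) (_ : 0 < ε),
    ⨅ (U : ℕ → Set α) (_ : S ⊆ ⋃ i, U i) (_ : ∀ i, ediamD d (U i) ≤ ε),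
      ∑' i, ediamD d (U i) ^ k

/-- The frontier of `U` is a rectifiable closed curve (for the Hilbert metric of `C`):
it is the image of a closed continuous curve and has finite one-dimensional Hausdorff
measure. -/
def RectCurveBoundary (C U : Set (Euc 2)) : Prop :=
  ∃ c : ℝ → Euc 2, ContinuousOn c (Icc 0 1) ∧ c '' Icc (0 : ℝ) 1 = frontier U ∧
    c 0 = c 1 ∧ hausD 1 (hDist C) (frontier U) < ⊤

/-- The Cheeger constant `I_∞^C(Ω)` in dimension `2`: infimum of
`ν_C(∂U)/μ_C(U)` over open sets `U` with closure contained in `Ω` whose boundary is a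
rectifiable curve, `ν_C` being the `1`-dimensional Hausdorff measure of `(C, d_C)`. -/
def cheeger2D (C Ω : Set (Euc 2)) : ℝ :=
  sInf {r : ℝ | ∃ U : Set (Euc 2), IsOpen U ∧ U.Nonempty ∧ closure U ⊆ Ω ∧
    RectCurveBoundary C U ∧
    r = (hausD 1 (hDist C) (frontier U)).toReal / (hMeasure C U).toReal}

/-- The Cheeger constant `I_∞(C)` of a planar Hilbert geometry. -/
def cheeger2 (C : Set (Euc 2)) : ℝ := cheeger2D C C

/-- `S` is a `C¹` hypersurface: near each of its points it is the zero set of a `C¹`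
function with nonvanishing differential. -/
def IsC1Hypersurface {n : ℕ} (S : Set (Euc n)) : Prop :=
  ∀ x ∈ S, ∃ (f : Euc n → ℝ) (U : Set (Euc n)), U ∈ nhds x ∧ ContDiffOn ℝ 1 f U ∧
    (∀ y ∈ U, fderiv ℝ f y ≠ 0) ∧ S ∩ U = {y ∈ U | f y = 0}

/-- The Cheeger constant `I_∞^C(Ω)` in dimension `n`: infimum of `ν_C(∂U)/μ_C(U)` over
open sets `U` with closure contained in `Ω` whose boundary is a `C¹` hypersurface,
`ν_C` being the `(n-1)`-dimensional Hausdorff measure of `(C, d_C)`. -/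
def cheegerND {n : ℕ} (C Ω : Set (Euc n)) : ℝ :=
  sInf {r : ℝ | ∃ U : Set (Euc n), IsOpen U ∧ U.Nonempty ∧ closure U ⊆ Ω ∧
    IsC1Hypersurface (frontier U) ∧
    r = (hausD ((n : ℝ) - 1) (hDist C) (frontier U)).toReal / (hMeasure C U).toReal}

/-- The boundary of the convex set `C` is of class `C¹`: through each boundary point
passes a unique supporting hyperplane. -/
def HasC1Boundary {n : ℕ} (C : Set (Euc n)) : Prop :=
  ∀ x ∈ frontier C, ∃! l : Euc n →L[ℝ] ℝ, ‖l‖ = 1 ∧ ∀ y ∈ C, l y ≤ l x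

/-- The convex set `C` is strictly convex: the open segment joining two distinct
boundary points is contained in `C`. -/
def IsStrictlyConvexSet {n : ℕ} (C : Set (Euc n)) : Prop :=
  ∀ x ∈ frontier C, ∀ y ∈ frontier C, x ≠ y → openSegment ℝ x y ⊆ C

end


section HilbertAux

open scoped Pointwise

theorem lp_neg {n : ℕ} (A : Set (Euc n)) (p u : Euc n) :
    lineParams A p (-u) = -lineParams A p u := by
  ext t; simp [lineParams]

theorem fNorm_eq {n : ℕ} (A : Set (Euc n)) (p u : Euc n) (hu : u ≠ 0) :
    fNorm A p u = (1/2) * ((sSup (lineParams A p u))⁻¹ + (sSup (lineParams A p (-u)))⁻¹) := by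
  rw [fNorm, if_neg hu, Real.sInf_def, lp_neg]
  rw [one_div (sSup _), one_div (-sSup _), inv_neg, sub_neg_eq_add]

theorem lp_bdd {n : ℕ} {A : Set (Euc n)} (hb : Bornology.IsBounded A) (p u : Euc n) (hu : u ≠ 0) :
    BddAbove (lineParams A p u) := by
  obtain ⟨R, hR⟩ := hb.subset_closedBall p
  refine ⟨R / ‖u‖, fun t ht => ?_⟩
  have h := hR ht
  have hu' : 0 < ‖u‖ := norm_pos_iff.2 hu
  rw [Metric.mem_closedBall, dist_eq_norm, add_sub_cancel_left, norm_smul] at h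
  rw [le_div_iff₀ hu']
  exact (mul_le_mul_of_nonneg_right (le_abs_self t) hu'.le).trans h

theorem lp_pos {n : ℕ} {A : Set (Euc n)} (ho : IsOpen A) (hb : Bornology.IsBounded A)
    {p : Euc n} (hp : p ∈ A) (u : Euc n) (hu : u ≠ 0) :
    0 < sSup (lineParams A p u) := by
  have hop : IsOpen (lineParams A p u) := ho.preimage (by fun_prop : Continuous fun t : ℝ => p + t • u)
  have h0 : (0:ℝ) ∈ lineParams A p u := by simpa [lineParams] using hp
  obtain ⟨ε, hε, hs⟩ := Metric.isOpen_iff.1 hop 0 h0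
  have h1 : ε / 2 ∈ lineParams A p u := hs (by
    simp [abs_of_pos hε]; linarith)
  exact (half_pos hε).trans_le (le_csSup (lp_bdd hb p u hu) h1)

theorem fNorm_pos {n : ℕ} {A : Set (Euc n)} (ho : IsOpen A) (hb : Bornology.IsBounded A)
    {p : Euc n} (hp : p ∈ A) (u : Euc n) (hu : u ≠ 0) : 0 < fNorm A p u := by
  rw [fNorm_eq A p u hu]
  have := lp_pos ho hb hp u hu
  have := lp_pos ho hb hp (-u) (neg_ne_zero.2 hu)
  positivity

theorem fNorm_neg {n : ℕ} (A : Set (Euc n)) (p u : Euc n) : fNorm A p (-u) = fNorm A p u := by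
  by_cases hu : u = 0
  · simp [hu]
  · rw [fNorm_eq A p u hu, fNorm_eq A p (-u) (neg_ne_zero.2 hu), neg_neg, add_comm]

theorem lp_sup_smul {n : ℕ} (A : Set (Euc n)) (p u : Euc n) {c : ℝ} (hc : 0 < c) :
    sSup (lineParams A p (c • u)) = c⁻¹ * sSup (lineParams A p u) := by
  have : lineParams A p (c • u) = c⁻¹ • lineParams A p u := by
    ext t
    rw [Set.mem_smul_set_iff_inv_smul_mem₀ (inv_ne_zero hc.ne')]
    simp [lineParams, smul_smul, mul_comm]
  rw [this, Real.sSup_smul_of_nonneg (by positivity), smul_eq_mul]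

theorem fNorm_smul {n : ℕ} (A : Set (Euc n)) (p u : Euc n) {c : ℝ} (hc : 0 < c) :
    fNorm A p (c • u) = c * fNorm A p u := by
  by_cases hu : u = 0
  · simp [hu, fNorm]
  · rw [fNorm_eq A p u hu, fNorm_eq A p (c • u) (smul_ne_zero hc.ne' hu), ← smul_neg,
      lp_sup_smul A p u hc, lp_sup_smul A p (-u) hc, mul_inv, mul_inv, inv_inv]
    ring

theorem lp_le {n : ℕ} {A B : Set (Euc n)} (hbB : Bornology.IsBounded B)
    {p q : Euc n} (hp : p ∈ A) {s : ℝ} (hs : 0 < s)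
    (h : ∀ v, p + v ∈ A → q + s • v ∈ B) (u : Euc n) (hu : u ≠ 0) :
    s * sSup (lineParams A p u) ≤ sSup (lineParams B q u) := by
  rw [mul_comm, ← le_div_iff₀ hs]
  refine csSup_le ⟨0, by simpa [lineParams] using hp⟩ fun t ht => ?_
  rw [le_div_iff₀ hs]
  refine le_csSup (lp_bdd hbB q u hu) ?_
  have := h _ ht
  rwa [smul_smul, mul_comm] at this

theorem fNorm_le {n : ℕ} {A B : Set (Euc n)} (hoA : IsOpen A) (hbA : Bornology.IsBounded A)
    (hbB : Bornology.IsBounded B)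
    {p q : Euc n} (hp : p ∈ A) {s : ℝ} (hs : 0 < s)
    (h : ∀ v, p + v ∈ A → q + s • v ∈ B) (u : Euc n) :
    s * fNorm B q u ≤ fNorm A p u := by
  by_cases hu : u = 0
  · simp [hu, fNorm]
  · have key : ∀ w : Euc n, w ≠ 0 →
        s * (sSup (lineParams B q w))⁻¹ ≤ (sSup (lineParams A p w))⁻¹ := by
      intro w hw
      have h1 := lp_pos hoA hbA hp w hw
      have h2 := lp_le hbB hp hs h w hw
      have h3 : 0 < sSup (lineParams B q w) := (mul_pos hs h1).trans_le h2
      rw [← div_eq_mul_inv, div_le_iff₀ h3, inv_mul_eq_div, le_div_iff₀ h1]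
      exact h2
    rw [fNorm_eq A p u hu, fNorm_eq B q u hu]
    linarith [key u hu, key (-u) (neg_ne_zero.2 hu)]

theorem fNorm_ball {n : ℕ} (u : Euc n) : fNorm (Metric.ball (0 : Euc n) 1) 0 u = ‖u‖ := by
  by_cases hu : u = 0
  · simp [hu, fNorm]
  · have key : ∀ w : Euc n, w ≠ 0 →
        sSup (lineParams (Metric.ball (0 : Euc n) 1) 0 w) = ‖w‖⁻¹ := by
      intro w hw
      have hw' : 0 < ‖w‖ := norm_pos_iff.2 hw
      have : lineParams (Metric.ball (0 : Euc n) 1) 0 w = Ioo (-‖w‖⁻¹) (‖w‖⁻¹) := by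
        ext t
        simp only [lineParams, mem_ofPred_eq, zero_add, mem_ball_zero_iff, norm_smul, mem_Ioo,
          Real.norm_eq_abs]
        rw [← abs_lt, ← one_div, lt_div_iff₀ hw']
      rw [this, csSup_Ioo]
      have := inv_pos.2 hw'
      linarith
    rw [fNorm_eq _ _ u hu, key u hu, key (-u) (neg_ne_zero.2 hu), norm_neg, inv_inv]
    ring

theorem fNorm_lower {n : ℕ} {A : Set (Euc n)} (hoA : IsOpen A) (hbA : Bornology.IsBounded A)
    {p : Euc n} (hp : p ∈ A) : ∃ R : ℝ, 0 < R ∧ ∀ u, ‖u‖ ≤ R * fNorm A p u := by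
  obtain ⟨R, hR0, hR⟩ := hbA.subset_ball_lt 0 p
  refine ⟨R, hR0, fun u => ?_⟩
  have := fNorm_le (B := Metric.ball (0 : Euc n) 1) (q := 0) hoA hbA Metric.isBounded_ball hp
    (inv_pos.2 hR0) (fun v hv => by
      have h := hR hv
      rw [Metric.mem_ball, dist_eq_norm, add_sub_cancel_left] at h
      rw [zero_add, mem_ball_zero_iff, norm_smul, norm_inv, Real.norm_of_nonneg hR0.le,
        inv_mul_lt_iff₀ hR0, mul_one]
      exact h) u
  rw [fNorm_ball, inv_mul_le_iff₀ hR0] at this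
  exact this

theorem fNorm_upper {n : ℕ} {A : Set (Euc n)} (hoA : IsOpen A) (hbA : Bornology.IsBounded A)
    {p : Euc n} (hp : p ∈ A) : ∃ r : ℝ, 0 < r ∧ ∀ u, r * fNorm A p u ≤ ‖u‖ := by
  obtain ⟨r, hr0, hr⟩ := Metric.isOpen_iff.1 hoA p hp
  refine ⟨r, hr0, fun u => ?_⟩
  have := fNorm_le (A := Metric.ball (0 : Euc n) 1) (p := 0) (q := p) Metric.isOpen_ball
    Metric.isBounded_ball hbA (by simp) hr0 (fun v hv => by
      rw [zero_add, mem_ball_zero_iff] at hv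
      refine hr ?_
      rw [Metric.mem_ball, dist_eq_norm, add_sub_cancel_left, norm_smul,
        Real.norm_of_nonneg hr0.le]
      nlinarith) u
  rwa [fNorm_ball] at this

/-! dual norm -/

theorem dual_nonneg {n : ℕ} (A : Set (Euc n)) (p : Euc n) (l : Euc n →L[ℝ] ℝ) :
    0 ≤ dualNorm A p l := by
  by_cases hB : BddAbove ((fun u => l u) '' {u : Euc n | fNorm A p u = 1})
  · rcases Set.eq_empty_or_nonempty {u : Euc n | fNorm A p u = 1} with he | ⟨u, hu⟩
    · simp [dualNorm, he]
    · have h1 : l u ≤ dualNorm A p l := le_csSup hB ⟨u, hu, rfl⟩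
      have h2 : l (-u) ≤ dualNorm A p l :=
        le_csSup hB ⟨-u, by rw [mem_ofPred_eq, fNorm_neg]; exact hu, rfl⟩
      rw [map_neg] at h2
      linarith
  · rw [dualNorm, Real.sSup_of_not_bddAbove hB]

theorem dual_zero {n : ℕ} (A : Set (Euc n)) (p : Euc n) : dualNorm A p 0 = 0 := by
  refine le_antisymm (Real.sSup_le ?_ le_rfl) (dual_nonneg A p 0)
  rintro _ ⟨u, -, rfl⟩
  simp

theorem le_dual {n : ℕ} {A : Set (Euc n)} (hoA : IsOpen A) (hbA : Bornology.IsBounded A)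
    {p : Euc n} (hp : p ∈ A) (l : Euc n →L[ℝ] ℝ) (u : Euc n) (hu : fNorm A p u = 1) :
    l u ≤ dualNorm A p l := by
  refine le_csSup ?_ ⟨u, hu, rfl⟩
  obtain ⟨R, hR0, hR⟩ := fNorm_lower hoA hbA hp
  refine ⟨‖l‖ * R, ?_⟩
  rintro _ ⟨v, hv, rfl⟩
  have := hR v
  rw [hv, mul_one] at this
  exact (le_abs_self _).trans ((l.le_opNorm v).trans (by gcongr))

theorem dual_lip {n : ℕ} {A : Set (Euc n)} (hoA : IsOpen A) (hbA : Bornology.IsBounded A)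
    {p : Euc n} (hp : p ∈ A) : Continuous fun l => dualNorm A p l := by
  obtain ⟨R, hR0, hR⟩ := fNorm_lower hoA hbA hp
  refine (LipschitzWith.of_le_add_mul (R.toNNReal) fun l l' => ?_).continuous
  rw [Real.coe_toNNReal _ hR0.le]
  refine Real.sSup_le ?_ (add_nonneg (dual_nonneg _ _ _) (by positivity))
  rintro _ ⟨v, hv, rfl⟩
  have h1 := hR v
  rw [hv, mul_one] at h1
  have h2 := le_dual hoA hbA hp l' v hv
  have h3 : (l - l') v ≤ ‖l - l'‖ * R :=
    (le_abs_self _).trans (((l - l').le_opNorm v).trans (by gcongr))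
  rw [sub_apply] at h3
  rw [dist_eq_norm]
  linarith

theorem dual_le {n : ℕ} {A B : Set (Euc n)}
    (hoB : IsOpen B) (hbB : Bornology.IsBounded B)
    {p q : Euc n} (hq : q ∈ B) {s : ℝ} (hs : 0 < s)
    (h : ∀ u, s * fNorm B q u ≤ fNorm A p u) (l : Euc n →L[ℝ] ℝ) :
    s * dualNorm A p l ≤ dualNorm B q l := by
  rw [mul_comm, ← le_div_iff₀ hs]
  have h0 := dual_nonneg B q l
  refine Real.sSup_le ?_ (by positivity)
  rintro _ ⟨u, hu, rfl⟩
  have hu0 : u ≠ 0 := by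
    rintro rfl
    simp [fNorm] at hu
  have hc := fNorm_pos hoB hbB hq u hu0
  have h1 := le_dual hoB hbB hq l ((fNorm B q u)⁻¹ • u) (by
    rw [fNorm_smul _ _ _ (inv_pos.2 hc), inv_mul_cancel₀ hc.ne'])
  rw [map_smul, smul_eq_mul, inv_mul_le_iff₀ hc] at h1
  have h2 := h u
  rw [hu] at h2
  change l u ≤ _
  rw [le_div_iff₀ hs]
  nlinarith

/-! density -/

theorem tb_pos {n : ℕ} {A : Set (Euc n)} (hoA : IsOpen A) (hbA : Bornology.IsBounded A)
    {p : Euc n} (hp : p ∈ A) : 0 < volume (tangentBall A p 1) := by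
  obtain ⟨r, hr0, hr⟩ := fNorm_upper hoA hbA hp
  refine (Metric.measure_ball_pos volume (0 : Euc n) hr0).trans_le (measure_mono fun u hu => ?_)
  rw [mem_ball_zero_iff] at hu
  have := hr u
  change fNorm A p u < 1
  by_contra hh
  push Not at hh
  nlinarith

theorem tb_fin {n : ℕ} {A : Set (Euc n)} (hoA : IsOpen A) (hbA : Bornology.IsBounded A)
    {p : Euc n} (hp : p ∈ A) : volume (tangentBall A p 1) < ⊤ := by
  obtain ⟨R, hR0, hR⟩ := fNorm_lower hoA hbA hp
  refine (measure_mono fun u hu => ?_).trans_lt (measure_ball_lt_top (x := (0 : Euc n)) (r := R))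
  rw [mem_ball_zero_iff]
  have h1 := hR u
  have h2 : fNorm A p u < 1 := hu
  nlinarith

theorem dens_le {n : ℕ} {A B : Set (Euc n)} (hoA : IsOpen A) (hbA : Bornology.IsBounded A)
    (hoB : IsOpen B) (hbB : Bornology.IsBounded B)
    {p q : Euc n} (hp : p ∈ A) (hq : q ∈ B) {s : ℝ} (hs : 0 < s)
    (h : ∀ u, s * fNorm B q u ≤ fNorm A p u) :
    ENNReal.ofReal (omegaVol n / (volume (tangentBall B q 1)).toReal) ≤
      ENNReal.ofReal ((s⁻¹) ^ n) *
      ENNReal.ofReal (omegaVol n / (volume (tangentBall A p 1)).toReal) := by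
  rw [← ENNReal.ofReal_mul (by positivity)]
  apply ENNReal.ofReal_le_ofReal
  have hsub : s • tangentBall A p 1 ⊆ tangentBall B q 1 := by
    rintro _ ⟨u, hu, rfl⟩
    change fNorm B q (s • u) < 1
    rw [fNorm_smul _ _ _ hs]
    exact (h u).trans_lt hu
  have h1 := ENNReal.toReal_mono (tb_fin hoB hbB hq).ne (measure_mono (μ := volume) hsub)
  rw [Measure.addHaar_smul, ENNReal.toReal_mul, finrank_euclideanSpace, Fintype.card_fin,
    abs_of_pos (by positivity), ENNReal.toReal_ofReal (by positivity)] at h1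
  have hA := ENNReal.toReal_pos (tb_pos hoA hbA hp).ne' (tb_fin hoA hbA hp).ne
  have hw : 0 ≤ omegaVol n := ENNReal.toReal_nonneg
  calc _ ≤ omegaVol n / (s ^ n * (volume (tangentBall A p 1)).toReal) := by gcongr
    _ = _ := by rw [inv_pow]; field_simp

/-! geometry -/

theorem geo {n : ℕ} {A B : Set (Euc n)} (hoB : IsOpen B) (hcB : Convex ℝ B)
    {p q : Euc n} {s r η : ℝ} (hs : 0 < s) (hs1 : s < 1)
    (hAB : ∀ x ∈ A, ∃ y ∈ closure B, dist x y < η) (hr : Metric.ball q r ⊆ B)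
    (hη : s * (dist q p + η) ≤ (1 - s) * r) :
    ∀ v, p + v ∈ A → q + s • v ∈ B := by
  intro v hv
  obtain ⟨y, hy, hd⟩ := hAB _ hv
  have h1s : 0 < 1 - s := by linarith
  set z : Euc n := q + (s / (1 - s)) • ((q - p) + (p + v - y)) with hz
  have hzB : z ∈ B := by
    apply hr
    rw [Metric.mem_ball, dist_eq_norm, hz, add_sub_cancel_left, norm_smul,
      Real.norm_of_nonneg (by positivity), div_mul_eq_mul_div, div_lt_iff₀ h1s, mul_comm r]
    refine lt_of_lt_of_le ?_ hη
    rw [dist_eq_norm] at hd ⊢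
    have := norm_add_le (q - p) (p + v - y)
    exact mul_lt_mul_of_pos_left (by linarith) hs
  have := hcB.combo_closure_interior_mem_interior hy (hoB.interior_eq.symm ▸ hzB) hs.le h1s
    (by ring)
  rw [hoB.interior_eq] at this
  convert this using 1
  rw [hz, smul_add, smul_smul, mul_div_cancel₀ _ h1s.ne']
  module

theorem ball_sub_of_near {n : ℕ} {A B : Set (Euc n)} (hoB : IsOpen B) (hcB : Convex ℝ B)
    (hne : B.Nonempty) {p : Euc n} {r : ℝ} (hr0 : 0 < r)
    (hAB : ∀ x ∈ A, ∃ y ∈ closure B, dist x y < r) (hr : Metric.ball p (2 * r) ⊆ A) :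
    Metric.ball p r ⊆ B := by
  intro q hq
  by_contra hqB
  obtain ⟨f, hf⟩ := geometric_hahn_banach_open_point hcB hoB hqB
  set w := (InnerProductSpace.toDual ℝ (Euc n)).symm f with hw
  have hfw : ∀ x, f x = inner ℝ w x := fun x => by
    rw [hw, InnerProductSpace.toDual_symm_apply]
  have hw0 : w ≠ 0 := by
    intro h
    obtain ⟨b, hb⟩ := hne
    have := hf b hb
    simp [hfw, h] at this
  have hwp : 0 < ‖w‖ := norm_pos_iff.2 hw0
  have hq' : q + (r / ‖w‖) • w ∈ A := by
    apply hr
    rw [Metric.mem_ball] at hq ⊢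
    calc dist (q + (r / ‖w‖) • w) p ≤ dist (q + (r / ‖w‖) • w) q + dist q p := dist_triangle _ _ _
      _ = r + dist q p := by
        rw [dist_eq_norm, add_sub_cancel_left, norm_smul, Real.norm_of_nonneg (by positivity),
          div_mul_cancel₀ _ hwp.ne']
      _ < 2 * r := by linarith
  obtain ⟨y, hy, hd⟩ := hAB _ hq'
  have hfy : f y ≤ f q :=
    closure_minimal (fun x hx => (hf x hx).le) (isClosed_le f.continuous continuous_const) hy
  have h1 : f (q + (r / ‖w‖) • w - y) ≤ ‖w‖ * ‖q + (r / ‖w‖) • w - y‖ := by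
    rw [hfw]; exact real_inner_le_norm _ _
  rw [← dist_eq_norm] at h1
  have h2 : f (q + (r / ‖w‖) • w - y) = f q - f y + r * ‖w‖ := by
    rw [map_sub, map_add, map_smul, hfw w, real_inner_self_eq_norm_sq, smul_eq_mul]
    field_simp
    ring
  nlinarith

/-! measurability -/

theorem dual_cont {n : ℕ} {A : Set (Euc n)} (hoA : IsOpen A) (hcA : Convex ℝ A)
    (hbA : Bornology.IsBounded A) (l : Euc n →L[ℝ] ℝ) :
    ContinuousOn (fun p => dualNorm A p l) A := by
  intro p hp
  apply ContinuousAt.continuousWithinAt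
  obtain ⟨r, hr0, hr⟩ := Metric.isOpen_iff.1 hoA p hp
  -- comparison with ratio `s q = r' / (r' + 2 d)`
  set s : Euc n → ℝ := fun q => 1 - (2 / r) * dist q p with hsdef
  have hsc : Continuous s := by fun_prop
  have hsp : s p = 1 := by simp [hsdef]
  have hev : ∀ᶠ q in nhds p, dist q p < r / 4 := Metric.ball_mem_nhds p (by positivity)
  have hboth : ∀ᶠ q in nhds p, s q * dualNorm A p l ≤ dualNorm A q l ∧
      s q * dualNorm A q l ≤ dualNorm A p l := by
    filter_upwards [hev] with q hq
    by_cases hqp : q = p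
    · subst hqp; simp [hsp]
    have hd : 0 < dist q p := dist_pos.2 hqp
    have hrq : 2 / r * dist q p < 1 / 2 := by
      rw [div_mul_eq_mul_div, div_lt_iff₀ hr0]; linarith
    have hs0 : 0 < s q := by simp only [hsdef]; linarith
    have hs1 : s q < 1 := by
      have : 0 < 2 / r * dist q p := by positivity
      simp only [hsdef]; linarith
    have hbq : Metric.ball q (r / 2) ⊆ A := (Metric.ball_subset_ball' (by linarith)).trans hr
    have hbp : Metric.ball p r ⊆ A := hr
    have hqA : q ∈ A := hbq (Metric.mem_ball_self (by positivity))
    have hη : ∃ η > 0, s q * (dist q p + η) ≤ (1 - s q) * (r / 2) := by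
      have e : (1 - s q) * (r / 2) = dist q p := by simp only [hsdef]; field_simp; ring
      refine ⟨(1 - s q) * dist q p, mul_pos (by linarith) hd, ?_⟩
      rw [e]
      nlinarith [mul_pos hd (sub_pos.2 hs1), mul_nonneg hd.le (sq_nonneg (1 - s q))]
    obtain ⟨η, hη0, hη⟩ := hη
    have hAA : ∀ x ∈ A, ∃ y ∈ closure A, dist x y < η := fun x hx =>
      ⟨x, subset_closure hx, by simpa using hη0⟩
    constructor
    · exact dual_le hoA hbA hqA hs0 (fNorm_le hoA hbA hbA hp hs0
        (geo hoA hcA hs0 hs1 hAA hbq hη)) l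
    · refine dual_le hoA hbA hp hs0 (fNorm_le hoA hbA hbA hqA hs0
        (geo hoA hcA hs0 hs1 hAA ((Metric.ball_subset_ball (by linarith)).trans hbp)
          (r := r / 2) ?_)) l
      rwa [dist_comm]
  have hspos : ∀ᶠ q in nhds p, 0 < s q :=
    hsc.continuousAt.eventually (lt_mem_nhds (by rw [hsp]; norm_num))
  have t1 : Tendsto (fun q => s q * dualNorm A p l) (nhds p) (nhds (dualNorm A p l)) := by
    have := (hsc.tendsto p).mul_const (dualNorm A p l)
    rwa [hsp, one_mul] at this
  have t2 : Tendsto (fun q => dualNorm A p l / s q) (nhds p) (nhds (dualNorm A p l)) := by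
    have := (tendsto_const_nhds (x := dualNorm A p l)).div (hsc.tendsto p) (by rw [hsp]; norm_num)
    rwa [hsp, div_one] at this
  refine tendsto_of_tendsto_of_tendsto_of_le_of_le' t1 t2 (hboth.mono fun q h => h.1) ?_
  filter_upwards [hboth, hspos] with q h h'
  rw [le_div_iff₀ h', mul_comm]
  exact h.2

theorem dual_meas {n : ℕ} {A : Set (Euc n)} (hoA : IsOpen A) (hcA : Convex ℝ A)
    (hbA : Bornology.IsBounded A) (f : Euc n → ℝ) :
    Measurable (A.indicator fun p => dualNorm A p (fderiv ℝ f p)) := by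
  classical
  have h := measurable_uncurry_of_continuous_of_measurable (m := inferInstance)
    (u := fun (l : Euc n →L[ℝ] ℝ) (p : Euc n) => A.indicator (fun p => dualNorm A p l) p) ?_ ?_
  · have h2 := h.comp ((measurable_fderiv ℝ f).prodMk measurable_id)
    exact h2
  · intro p
    by_cases hp : p ∈ A
    · simpa [hp] using dual_lip hoA hbA hp
    · simpa [hp] using continuous_const
  · intro l
    exact (dual_cont hoA hcA hbA l).measurable_piecewise continuousOn_const hoA.measurableSet

/-! comparison of measures and of Rayleigh quotients -/

theorem hMeasure_restrict_le {n : ℕ} {A B K : Set (Euc n)}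
    (hoA : IsOpen A) (hbA : Bornology.IsBounded A)
    (hoB : IsOpen B) (hbB : Bornology.IsBounded B) (hK : MeasurableSet K)
    (hKA : K ⊆ A) (hKB : K ⊆ B) {s : ℝ} (hs : 0 < s)
    (h : ∀ p ∈ K, ∀ u, s * fNorm B p u ≤ fNorm A p u) :
    (hMeasure B).restrict K ≤ ENNReal.ofReal ((s⁻¹) ^ n) • (hMeasure A).restrict K := by
  rw [hMeasure, hMeasure, restrict_withDensity hK, restrict_withDensity hK,
    Measure.restrict_restrict_of_subset hKA, Measure.restrict_restrict_of_subset hKB,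
    ← withDensity_smul' _ _ ENNReal.ofReal_ne_top]
  refine withDensity_mono (ae_restrict_of_forall_mem hK fun p hp => ?_)
  exact dens_le hoA hbA hoB hbB (hKA hp) (hKB hp) hs (h p hp)

theorem integral_le_of_measure_le {α : Type*} [MeasurableSpace α] {μ ν : Measure α} {c : ℝ}
    (hc : 0 ≤ c) (h : ν ≤ ENNReal.ofReal c • μ) {g : α → ℝ} (hg : ∀ x, 0 ≤ g x)
    (hi : Integrable g μ) : ∫ x, g x ∂ν ≤ c * ∫ x, g x ∂μ := by
  have := integral_mono_measure h (Eventually.of_forall hg) (hi.smul_measure ENNReal.ofReal_ne_top)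
  rwa [integral_smul_measure, ENNReal.toReal_ofReal hc, smul_eq_mul] at this

theorem core {n : ℕ} {A C : Set (Euc n)}
    (hoA : IsOpen A) (hbA : Bornology.IsBounded A)
    (hoC : IsOpen C) (hcC : Convex ℝ C) (hbC : Bornology.IsBounded C)
    {f : Euc n → ℝ} (hf : Continuous f)
    (hKA : tsupport f ⊆ A) (hKC : tsupport f ⊆ C) {s lam : ℝ} (hs : 0 < s) (hlam : 0 < lam)
    (hAC : ∀ p ∈ tsupport f, ∀ u, s * fNorm C p u ≤ fNorm A p u)
    (hCA : ∀ p ∈ tsupport f, ∀ u, s * fNorm A p u ≤ fNorm C p u)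
    (hray : lam ≤ rayleigh A A f) : s ^ (2 * n + 2) * lam ≤ rayleigh C C f := by
  set K := tsupport f with hKdef
  have hKm : MeasurableSet K := (isClosed_tsupport f).measurableSet
  have red : ∀ {B : Set (Euc n)}, IsOpen B → K ⊆ B → rayleigh B B f =
      (∫ p in K, dualNorm B p (fderiv ℝ f p) ^ 2 ∂hMeasure B) / ∫ p in K, f p ^ 2 ∂hMeasure B := by
    intro B hB hKB
    rw [rayleigh]
    congr 1
    · refine setIntegral_eq_of_subset_of_forall_sdiff_eq_zero hB.measurableSet hKB fun p hp => ?_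
      have : fderiv ℝ f p = 0 := by
        by_contra hne
        exact hp.2 (support_fderiv_subset ℝ hne)
      rw [this, dual_zero]; norm_num
    · refine setIntegral_eq_of_subset_of_forall_sdiff_eq_zero hB.measurableSet hKB fun p hp => ?_
      rw [image_eq_zero_of_notMem_tsupport hp.2]; norm_num
  rw [red hoA hKA] at hray
  rw [red hoC hKC]
  have hνμ := hMeasure_restrict_le hoC hbC hoA hbA hKm hKC hKA hs hCA
  have hμν := hMeasure_restrict_le hoA hbA hoC hbC hKm hKA hKC hs hAC
  set ν := (hMeasure A).restrict K with hν
  set μ := (hMeasure C).restrict K with hμ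
  set c := (s⁻¹) ^ n with hc
  have hc0 : 0 < c := by positivity
  set Gi : Euc n → ℝ := fun p => dualNorm A p (fderiv ℝ f p) ^ 2 with hGi
  set G : Euc n → ℝ := fun p => dualNorm C p (fderiv ℝ f p) ^ 2 with hG
  have hDi0 : 0 ≤ ∫ p, f p ^ 2 ∂ν := integral_nonneg fun p => sq_nonneg _
  have hDine : ∫ p, f p ^ 2 ∂ν ≠ 0 := by
    intro h
    rw [h, div_zero] at hray
    linarith
  have hDip : 0 < ∫ p, f p ^ 2 ∂ν := lt_of_le_of_ne hDi0 hDine.symm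
  have hNi : lam * ∫ p, f p ^ 2 ∂ν ≤ ∫ p, Gi p ∂ν := (le_div_iff₀ hDip).1 hray
  have hNine : ∫ p, Gi p ∂ν ≠ 0 := ((mul_pos hlam hDip).trans_le hNi).ne'
  have hfν : Integrable (fun p => f p ^ 2) ν := by
    by_contra h
    exact hDine (integral_undef h)
  have hGiν : Integrable Gi ν := by
    by_contra h
    exact hNine (integral_undef h)
  have hfμ : Integrable (fun p => f p ^ 2) μ :=
    (hfν.smul_measure ENNReal.ofReal_ne_top).mono_measure hμν
  have hGle : ∀ p ∈ K, G p ≤ (s⁻¹) ^ 2 * Gi p := by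
    intro p hp
    have h1 := dual_le hoA hbA (hKA hp) hs (hCA p hp) (fderiv ℝ f p)
    have h0 := dual_nonneg C p (fderiv ℝ f p)
    have h2 : dualNorm C p (fderiv ℝ f p) ≤ s⁻¹ * dualNorm A p (fderiv ℝ f p) := by
      rwa [inv_mul_eq_div, le_div_iff₀ hs, mul_comm]
    simp only [hG, hGi]
    rw [← mul_pow]
    gcongr
  have hGile : ∀ p ∈ K, Gi p ≤ (s⁻¹) ^ 2 * G p := by
    intro p hp
    have h1 := dual_le hoC hbC (hKC hp) hs (hAC p hp) (fderiv ℝ f p)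
    have h0 := dual_nonneg A p (fderiv ℝ f p)
    have h2 : dualNorm A p (fderiv ℝ f p) ≤ s⁻¹ * dualNorm C p (fderiv ℝ f p) := by
      rwa [inv_mul_eq_div, le_div_iff₀ hs, mul_comm]
    simp only [hG, hGi]
    rw [← mul_pow]
    gcongr
  have hGm : AEStronglyMeasurable G ν := by
    have hm := ((dual_meas hoC hcC hbC f).pow_const 2).aestronglyMeasurable (μ := ν)
    refine hm.congr (ae_restrict_of_forall_mem hKm fun p hp => ?_)
    simp [hG, indicator_of_mem (hKC hp)]
  have hGν : Integrable G ν := by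
    refine (hGiν.const_mul ((s⁻¹) ^ 2)).mono' hGm (ae_restrict_of_forall_mem hKm fun p hp => ?_)
    rw [Real.norm_of_nonneg (sq_nonneg _)]
    exact hGle p hp
  have hGμ : Integrable G μ := (hGν.smul_measure ENNReal.ofReal_ne_top).mono_measure hμν
  have e1 : ∫ p, Gi p ∂ν ≤ (s⁻¹) ^ 2 * ∫ p, G p ∂ν := by
    rw [← integral_const_mul]
    exact integral_mono_ae hGiν (hGν.const_mul _) (ae_restrict_of_forall_mem hKm hGile)
  have e2 := integral_le_of_measure_le hc0.le hνμ (fun p => sq_nonneg _ : ∀ p, 0 ≤ G p) hGμ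
  have e3 := integral_le_of_measure_le hc0.le hνμ (fun p => sq_nonneg (f p)) hfμ
  have e4 := integral_le_of_measure_le hc0.le hμν (fun p => sq_nonneg (f p)) hfν
  have hDp : 0 < ∫ p, f p ^ 2 ∂μ := by
    by_contra h
    push Not at h
    have := mul_nonpos_of_nonneg_of_nonpos hc0.le h
    linarith
  rw [le_div_iff₀ hDp]
  have hpow : s ^ (2 * n + 2) * c * c * (s⁻¹) ^ 2 = 1 := by
    rw [hc, inv_pow, inv_pow]; field_simp; ring
  calc s ^ (2 * n + 2) * lam * ∫ p, f p ^ 2 ∂μ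
      ≤ s ^ (2 * n + 2) * lam * (c * ∫ p, f p ^ 2 ∂ν) := by gcongr
    _ = s ^ (2 * n + 2) * c * (lam * ∫ p, f p ^ 2 ∂ν) := by ring
    _ ≤ s ^ (2 * n + 2) * c * ((s⁻¹) ^ 2 * (c * ∫ p, G p ∂μ)) := by
        refine mul_le_mul_of_nonneg_left (hNi.trans (e1.trans ?_)) (by positivity)
        exact mul_le_mul_of_nonneg_left e2 (by positivity)
    _ = (s ^ (2 * n + 2) * c * c * (s⁻¹) ^ 2) * ∫ p, G p ∂μ := by ring
    _ = _ := by rw [hpow, one_mul]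

theorem rayleigh_nonneg {n : ℕ} (A B : Set (Euc n)) (f : Euc n → ℝ) : 0 ≤ rayleigh A B f :=
  div_nonneg (integral_nonneg fun _ => sq_nonneg _) (integral_nonneg fun _ => sq_nonneg _)

theorem testFuns_nonempty {n : ℕ} {C : Set (Euc n)} (ho : IsOpen C) (hne : C.Nonempty) :
    (testFuns C).Nonempty := by
  obtain ⟨p, hp⟩ := hne
  obtain ⟨r, hr0, hr⟩ := Metric.isOpen_iff.1 ho p hp
  have hsub : tsupport (fun x : Euc n => max (r / 2 - dist x p) 0) ⊆ Metric.closedBall p (r / 2) := by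
    refine closure_minimal (fun x hx => ?_) Metric.isClosed_closedBall
    rw [Metric.mem_closedBall]
    by_contra h
    push Not at h
    exact hx (max_eq_right (by linarith))
  refine ⟨fun x => max (r / 2 - dist x p) 0, ⟨1, ?_⟩, ?_, ?_, ?_⟩
  · refine LipschitzWith.max_const ?_ 0
    refine LipschitzWith.of_le_add fun x y => ?_
    have := dist_triangle y x p
    rw [dist_comm y x] at this
    linarith
  · intro h
    have := congrFun h p
    simp at this
    linarith
  · exact (isCompact_closedBall p (r / 2)).of_isClosed_subset (isClosed_tsupport _) hsub
  · exact hsub.trans ((Metric.closedBall_subset_ball (by linarith)).trans hr)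

end HilbertAux

/-- if `λ₁(Cᵢ) ≥ λ` for a sequence of bounded open convex sets whose
closures converge in Hausdorff distance to the closure of the bounded open convex set
`C`, then `λ₁(C) ≥ λ`. -/
theorem stmt3 {n : ℕ} (lam : ℝ) (hlam : 0 < lam) (Cseq : ℕ → Set (Euc n))
    (C : Set (Euc n))
    (hconv' : ∀ i, Convex ℝ (Cseq i)) (hopen' : ∀ i, IsOpen (Cseq i))
    (hbdd' : ∀ i, Bornology.IsBounded (Cseq i)) (hne' : ∀ i, (Cseq i).Nonempty)
    (hconv : Convex ℝ C) (hopen : IsOpen C)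
    (hbdd : Bornology.IsBounded C) (hne : C.Nonempty)
    (hlower : ∀ i, lambda1 (Cseq i) ≥ lam)
    (hconvg : Filter.Tendsto
      (fun i => Metric.hausdorffDist (closure (Cseq i)) (closure C))
      Filter.atTop (nhds 0)) :
    lambda1 C ≥ lam := by
  refine le_csInf ((testFuns_nonempty hopen hne).image _) ?_
  rintro _ ⟨f, ⟨⟨L, hL⟩, hf0, hfc, hfC⟩, rfl⟩
  -- it suffices to bound by `s ^ (2n+2) * lam` for `s < 1`
  have main : ∀ s : ℝ, 0 < s → s < 1 → s ^ (2 * n + 2) * lam ≤ rayleigh C C f := by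
    intro s hs hs1
    obtain ⟨δ, hδ0, hδ⟩ := IsCompact.exists_thickening_subset_open hfc hopen hfC
    set r := δ / 2 with hr
    have hr0 : 0 < r := by positivity
    have hball : ∀ p ∈ tsupport f, Metric.ball p (2 * r) ⊆ C := fun p hp =>
      (Metric.ball_subset_thickening hp _).trans (by rw [hr, mul_div_cancel₀ _ two_ne_zero]; exact hδ)
    have h1s : 0 < 1 - s := by linarith
    set η := min r ((1 - s) * r) with hη
    have hη0 : 0 < η := lt_min hr0 (mul_pos h1s hr0)
    obtain ⟨i, hi⟩ := (hconvg.eventually (gt_mem_nhds hη0)).exists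
    have hfin : Metric.hausdorffEDist (closure (Cseq i)) (closure C) ≠ ⊤ :=
      Metric.hausdorffEDist_ne_top_of_nonempty_of_bounded (hne' i).closure hne.closure
        (hbdd' i).closure hbdd.closure
    have hAC : ∀ x ∈ Cseq i, ∃ y ∈ closure C, dist x y < η := fun x hx =>
      Metric.exists_dist_lt_of_hausdorffDist_lt (subset_closure hx) hi hfin
    have hCA : ∀ x ∈ C, ∃ y ∈ closure (Cseq i), dist x y < η := fun x hx => by
      obtain ⟨y, hy, hd⟩ :=
        Metric.exists_dist_lt_of_hausdorffDist_lt' (subset_closure hx) hi hfin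
      exact ⟨y, hy, by rwa [dist_comm]⟩
    have hball' : ∀ p ∈ tsupport f, Metric.ball p r ⊆ Cseq i := fun p hp =>
      ball_sub_of_near (hopen' i) (hconv' i) (hne' i) hr0
        (fun x hx => by
          obtain ⟨y, hy, hd⟩ := hCA x hx
          exact ⟨y, hy, hd.trans_le (min_le_left _ _)⟩) (hball p hp)
    have hfA : tsupport f ⊆ Cseq i := fun p hp => hball' p hp (Metric.mem_ball_self hr0)
    have hcond : ∀ p : Euc n, s * (dist p p + η) ≤ (1 - s) * r := fun p => by
      rw [dist_self, zero_add]
      have : η ≤ (1 - s) * r := min_le_right _ _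
      nlinarith
    refine core (hopen' i) (hbdd' i) hopen hconv hbdd hL.continuous hfA hfC hs hlam ?_ ?_ ?_
    · exact fun p hp => fNorm_le (hopen' i) (hbdd' i) hbdd (hfA hp) hs
        (geo hopen hconv hs hs1 hAC
          ((Metric.ball_subset_ball (by linarith)).trans (hball p hp)) (hcond p))
    · exact fun p hp => fNorm_le hopen hbdd (hbdd' i) (hfC hp) hs
        (geo (hopen' i) (hconv' i) hs hs1 hCA (hball' p hp) (hcond p))
    · refine (hlower i).le.trans (csInf_le ⟨0, ?_⟩ ⟨f, ⟨⟨L, hL⟩, hf0, hfc, hfA⟩, rfl⟩)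
      rintro _ ⟨g, -, rfl⟩
      exact rayleigh_nonneg _ _ _
  have ht : Tendsto (fun s : ℝ => s ^ (2 * n + 2) * lam) (nhdsWithin 1 (Iio 1)) (nhds lam) := by
    have hc : Continuous fun s : ℝ => s ^ (2 * n + 2) * lam := by fun_prop
    have := (hc.tendsto 1).mono_left (nhdsWithin_le_nhds (s := Iio (1 : ℝ)))
    simpa using this
  refine le_of_tendsto ht ?_
  filter_upwards [self_mem_nhdsWithin,
    nhdsWithin_le_nhds (lt_mem_nhds (zero_lt_one : (0 : ℝ) < 1))] with s h1 h0
  exact main s h0 h1
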